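/- Let A = K[σ^∨ ∩ M] be an affine semigroup algebra over a field K of characteristic 0 and ∂ a nonzero homogeneous locally nilpotent derivation on A. Then ker ∂ = K[τ ∩ M] for some facet (codimension-1 face) τ of σ^∨. In particular, ker ∂ is a finitely generated K-algebra. -/

import Mathlib

open scoped BigOperators Pointwise

noncomputable section

/-- Rational `n`-space `N_ℚ ≅ M_ℚ ≅ ℚⁿ`. -/
abbrev Vec (n : ℕ) := Fin n → ℚ

/-- The natural pairing `M_ℚ × N_ℚ → ℚ`. -/
def pairQ {n : ℕ} (m p : Vec n) : ℚ := ∑ i, m i * p i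

/-- The dual cone of a subset of `N_ℚ`. -/
def dualCone {n : ℕ} (σ : Set (Vec n)) : Set (Vec n) :=
  {m | ∀ p ∈ σ, 0 ≤ pairQ m p}

/-- Inclusion of the lattice `M = ℤⁿ` into `M_ℚ`. -/
def toQ {n : ℕ} (v : Fin n → ℤ) : Vec n := fun i => (v i : ℚ)

/-- A vector of `ℚⁿ` is a lattice vector if all its coordinates are integers. -/
def IsLatticeVec {n : ℕ} (v : Vec n) : Prop := ∀ i, ∃ z : ℤ, v i = (z : ℚ)

/-- The convex cone generated by a set: all finite nonnegative rational combinations. -/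
def coneHull {n : ℕ} (S : Set (Vec n)) : Set (Vec n) :=
  {x | ∃ (G : Finset (Vec n)) (c : Vec n → ℚ), ↑G ⊆ S ∧ (∀ g, 0 ≤ c g) ∧
    x = ∑ g ∈ G, c g • g}

/-- A rational polyhedral cone: the cone generated by finitely many lattice vectors. -/
def IsRatPolyCone {n : ℕ} (σ : Set (Vec n)) : Prop :=
  ∃ G : Finset (Vec n), (∀ g ∈ G, IsLatticeVec g) ∧ σ = coneHull ↑G

/-- A cone is pointed if it contains no line through the origin. -/
def PointedCone' {n : ℕ} (σ : Set (Vec n)) : Prop := σ ∩ (-σ) ⊆ {0}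

/-- A cone is of full dimension if it spans the ambient space. -/
def FullDim {n : ℕ} (σ : Set (Vec n)) : Prop := Submodule.span ℚ σ = ⊤

/-- `ρ` is the extremal ray of `σ` generated by the primitive lattice vector `ν`. -/
def IsExtremalRay {n : ℕ} (σ ρ : Set (Vec n)) (ν : Vec n) : Prop :=
  IsLatticeVec ν ∧ ν ≠ 0 ∧ (∀ c : ℚ, 0 < c → IsLatticeVec (c • ν) → 1 ≤ c) ∧
  ρ = {x | ∃ c : ℚ, 0 ≤ c ∧ x = c • ν} ∧ ρ ⊆ σ ∧
  (∀ x ∈ σ, ∀ y ∈ σ, x + y ∈ ρ → x ∈ ρ)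

/-- The submonoid `σ^∨ ∩ M` of lattice points of the dual cone. -/
def latticeCone {n : ℕ} (σ : Set (Vec n)) : AddSubmonoid (Fin n → ℤ) where
  carrier := {m | toQ m ∈ dualCone σ}
  zero_mem' := by
    intro p hp
    simp [pairQ, toQ]
  add_mem' := by
    intro a b ha hb p hp
    have h : pairQ (toQ (a + b)) p = pairQ (toQ a) p + pairQ (toQ b) p := by
      simp [pairQ, toQ, add_mul, Finset.sum_add_distrib]
    rw [h]
    exact add_nonneg (ha p hp) (hb p hp)

/-- A derivation is locally nilpotent if every element is annihilated by some iterate. -/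
def IsLND {R A : Type*} [CommRing R] [CommRing A] [Algebra R A]
    (D : Derivation R A A) : Prop :=
  ∀ a : A, ∃ k : ℕ, (⇑D)^[k] a = 0

/-- **Farkas' lemma**: a functional that is nonnegative wherever finitely many given functionals
are nonnegative is a nonnegative combination of them. -/
theorem exists_nonneg_combination {W ι : Type*} [AddCommGroup W] [Module ℚ W] (s : Finset ι) :
    ∀ (α : ι → W →ₗ[ℚ] ℚ) (γ : W →ₗ[ℚ] ℚ), (∀ x, (∀ i ∈ s, 0 ≤ α i x) → 0 ≤ γ x) →
      ∃ c : ι → ℚ, (∀ i, 0 ≤ c i) ∧ γ = ∑ i ∈ s, c i • α i := by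
  classical
  induction s using Finset.induction_on with
  | empty =>
    intro α γ h
    refine ⟨0, fun _ => le_rfl, ?_⟩
    ext x
    have h₁ := h x (by simp)
    have h₂ := h (-x) (by simp)
    rw [map_neg] at h₂
    simpa using le_antisymm (by linarith) h₁
  | insert a s ha ih =>
    intro α γ h
    by_cases hs : ∀ x, (∀ i ∈ s, 0 ≤ α i x) → 0 ≤ γ x
    · obtain ⟨c, hc, hγ⟩ := ih α γ hs
      refine ⟨Function.update c a 0, fun i => ?_, ?_⟩
      · rcases eq_or_ne i a with rfl | hi
        · simp
        · simpa [hi] using hc i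
      · rw [Finset.sum_insert ha, hγ]
        simp only [Function.update_self, zero_smul, zero_add]
        refine Finset.sum_congr rfl fun i hi => ?_
        rw [Function.update_of_ne (ne_of_mem_of_not_mem hi ha)]
    · push Not at hs
      obtain ⟨x₀, hx₀, hγ₀⟩ := hs
      have ha₀ : α a x₀ < 0 := by
        by_contra! hcon
        refine hγ₀.not_ge (h x₀ fun i hi => ?_)
        rcases Finset.mem_insert.1 hi with rfl | hi
        exacts [hcon, hx₀ i hi]
      obtain ⟨x₁, hx₁, hγ₁, ha₁⟩ :
          ∃ x, (∀ i ∈ s, 0 ≤ α i x) ∧ γ x < 0 ∧ α a x = -1 := by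
        have hpos : 0 < (-α a x₀)⁻¹ := inv_pos.2 (neg_pos.2 ha₀)
        refine ⟨(-α a x₀)⁻¹ • x₀, fun i hi => ?_, ?_, ?_⟩
        · rw [map_smul, smul_eq_mul]
          exact mul_nonneg hpos.le (hx₀ i hi)
        · rw [map_smul, smul_eq_mul]
          exact mul_neg_of_pos_of_neg hpos hγ₀
        · rw [map_smul, smul_eq_mul]
          field_simp [ha₀.ne]
      obtain ⟨c, hc, hγ⟩ := ih (fun i => α i + α i x₁ • α a) (γ + γ x₁ • α a) fun x hx => by
        have key := h (x + α a x • x₁) fun i hi => by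
          rcases Finset.mem_insert.1 hi with rfl | hi
          · simp [ha₁]
          · simpa [mul_comm] using hx i hi
        simpa [mul_comm] using key
      have hsum : 0 ≤ ∑ i ∈ s, c i * α i x₁ :=
        Finset.sum_nonneg fun i hi => mul_nonneg (hc i) (hx₁ i hi)
      refine ⟨Function.update c a (∑ i ∈ s, c i * α i x₁ - γ x₁), fun i => ?_, ?_⟩
      · rcases eq_or_ne i a with rfl | hi
        · simp only [Function.update_self]
          linarith
        · simpa [hi] using hc i
      · rw [Finset.sum_insert ha, Function.update_self]
        have hcongr : ∑ i ∈ s, Function.update c a (∑ i ∈ s, c i * α i x₁ - γ x₁) i • α i =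
            ∑ i ∈ s, c i • α i := Finset.sum_congr rfl fun i hi => by
          rw [Function.update_of_ne (ne_of_mem_of_not_mem hi ha)]
        rw [hcongr]
        refine (eq_sub_of_add_eq hγ).trans ?_
        simp only [smul_add, Finset.sum_add_distrib, smul_smul, sub_smul, Finset.sum_smul]
        abel

section Cones

variable {n : ℕ}

/-- Pairing with a fixed vector of `N_ℚ`, as a linear functional on `M_ℚ`. -/
def pairLin (p : Vec n) : Vec n →ₗ[ℚ] ℚ where
  toFun m := pairQ m p
  map_add' a b := add_dotProduct a b p
  map_smul' c a := smul_dotProduct c a p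

theorem pairLin_apply (m p : Vec n) : pairLin p m = pairQ m p := rfl

theorem pairQ_add_left (a b p : Vec n) : pairQ (a + b) p = pairQ a p + pairQ b p :=
  add_dotProduct a b p

theorem pairQ_smul_left (c : ℚ) (a p : Vec n) : pairQ (c • a) p = c * pairQ a p :=
  smul_dotProduct c a p

theorem pairQ_sum_left {ι : Type*} (s : Finset ι) (f : ι → Vec n) (p : Vec n) :
    pairQ (∑ i ∈ s, f i) p = ∑ i ∈ s, pairQ (f i) p :=
  sum_dotProduct s f p

theorem pairQ_add_right (m p q : Vec n) : pairQ m (p + q) = pairQ m p + pairQ m q :=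
  dotProduct_add m p q

theorem pairQ_smul_right (c : ℚ) (m p : Vec n) : pairQ m (c • p) = c * pairQ m p :=
  dotProduct_smul c m p

theorem pairQ_neg_right (m p : Vec n) : pairQ m (-p) = -pairQ m p :=
  dotProduct_neg m p

theorem pairQ_sum_right {ι : Type*} (s : Finset ι) (m : Vec n) (f : ι → Vec n) :
    pairQ m (∑ i ∈ s, f i) = ∑ i ∈ s, pairQ m (f i) :=
  dotProduct_sum m s f

theorem pairQ_single_left (i : Fin n) (p : Vec n) : pairQ (Pi.single i 1) p = p i :=
  single_one_dotProduct i p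

theorem toQ_add (a b : Fin n → ℤ) : toQ (a + b) = toQ a + toQ b := by
  ext i; simp [toQ]

theorem toQ_nsmul (k : ℕ) (a : Fin n → ℤ) : toQ (k • a) = (k : ℚ) • toQ a := by
  ext i; simp [toQ]

theorem exists_nsmul_eq_toQ (v : Vec n) :
    ∃ N : ℕ, 0 < N ∧ ∃ z : Fin n → ℤ, toQ z = (N : ℚ) • v := by
  refine ⟨∏ i, (v i).den, Finset.prod_pos fun i _ => (v i).den_pos, ?_⟩
  have h : ∀ i, ∃ z : ℤ, (z : ℚ) = ((∏ j, (v j).den : ℕ) : ℚ) * v i := fun i => by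
    obtain ⟨k, hk⟩ := Finset.dvd_prod_of_mem (fun j => (v j).den) (Finset.mem_univ i)
    refine ⟨k * (v i).num, ?_⟩
    rw [hk]
    push_cast
    rw [← Rat.mul_den_eq_num (v i)]
    ring
  choose z hz using h
  exact ⟨z, funext hz⟩

theorem subset_coneHull (S : Set (Vec n)) : S ⊆ coneHull S := fun g hg =>
  ⟨{g}, fun _ => 1, by simpa using hg, fun _ => zero_le_one, by simp⟩

theorem mem_dualCone_coneHull {S : Set (Vec n)} {m : Vec n} :
    m ∈ dualCone (coneHull S) ↔ ∀ g ∈ S, 0 ≤ pairQ m g := by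
  refine ⟨fun h g hg => h g (subset_coneHull S hg), ?_⟩
  rintro h _ ⟨G, c, hG, hc, rfl⟩
  rw [pairQ_sum_right]
  refine Finset.sum_nonneg fun g hg => ?_
  rw [pairQ_smul_right]
  exact mul_nonneg (hc g) (h g (hG hg))

/-- A finitely generated cone equals its bidual. -/
theorem mem_coneHull_of_forall_dualCone {G : Finset (Vec n)} {x : Vec n}
    (h : ∀ m ∈ dualCone (coneHull (G : Set (Vec n))), 0 ≤ pairQ m x) :
    x ∈ coneHull (G : Set (Vec n)) := by
  obtain ⟨c, hc, hx⟩ := exists_nonneg_combination G pairLin (pairLin x) fun m hm =>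
    h m (mem_dualCone_coneHull.2 hm)
  refine ⟨G, c, subset_rfl, hc, ?_⟩
  ext i
  have := LinearMap.congr_fun hx (Pi.single i 1)
  simpa [pairLin_apply, pairQ_single_left] using this

theorem mem_coneHull_of_forall_latticeCone {G : Finset (Vec n)} {x : Vec n}
    (h : ∀ m ∈ latticeCone (coneHull (G : Set (Vec n))), 0 ≤ pairQ (toQ m) x) :
    x ∈ coneHull (G : Set (Vec n)) := by
  refine mem_coneHull_of_forall_dualCone fun m hm => ?_
  obtain ⟨N, hN, z, hz⟩ := exists_nsmul_eq_toQ m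
  have hN' : (0 : ℚ) < N := Nat.cast_pos.2 hN
  have hx := h z fun p hp => by
    rw [hz, pairQ_smul_left]
    exact mul_nonneg hN'.le (hm p hp)
  rw [hz, pairQ_smul_left] at hx
  exact nonneg_of_mul_nonneg_right hx hN'

/-- The dual of a pointed polyhedral cone has an interior point. -/
theorem exists_pairQ_pos {G : Finset (Vec n)}
    (hpt : PointedCone' (coneHull (G : Set (Vec n)))) :
    ∃ u ∈ latticeCone (coneHull (G : Set (Vec n))),
      ∀ g ∈ G, g ≠ 0 → 0 < pairQ (toQ u) g := by
  have h : ∀ g : Vec n, ∃ m ∈ latticeCone (coneHull (G : Set (Vec n))),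
      g ∈ G → g ≠ 0 → 0 < pairQ (toQ m) g := fun g => by
    by_contra! hcon
    obtain ⟨hg, hg0, -⟩ := hcon 0 (zero_mem _)
    refine hg0 (hpt ⟨subset_coneHull _ hg, ?_⟩)
    refine mem_coneHull_of_forall_latticeCone fun m hm => ?_
    rw [pairQ_neg_right]
    exact neg_nonneg.2 (hcon m hm).2.2
  choose u hu hpos using h
  refine ⟨∑ g ∈ G, u g, sum_mem fun g _ => hu g, fun g hg hg0 => ?_⟩
  have hsum : toQ (∑ g ∈ G, u g) = ∑ g ∈ G, toQ (u g) := by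
    ext i; simp [toQ]
  rw [hsum, pairQ_sum_left]
  exact Finset.sum_pos' (fun g' _ => hu g' g (subset_coneHull _ hg)) ⟨g, hg, hpos g hg hg0⟩

/-- The lattice points of the dual of a pointed polyhedral cone generate `M` as a group. -/
theorem exists_eq_sub_latticeCone {G : Finset (Vec n)}
    (hpt : PointedCone' (coneHull (G : Set (Vec n)))) (v : Fin n → ℤ) :
    ∃ a b : latticeCone (coneHull (G : Set (Vec n))), v = (a : Fin n → ℤ) - b := by
  obtain ⟨u, hu, hpos⟩ := exists_pairQ_pos hpt
  have h : ∀ᶠ N : ℕ in Filter.atTop, ∀ g ∈ G, 0 ≤ pairQ (toQ (v + N • u)) g := by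
    refine (Filter.eventually_all_finset G).2 fun g hg => ?_
    rcases eq_or_ne g 0 with rfl | hg0
    · simp [pairQ]
    · obtain ⟨N₀, hN₀⟩ := exists_nat_ge (-pairQ (toQ v) g / pairQ (toQ u) g)
      filter_upwards [Filter.eventually_ge_atTop N₀] with N hN
      have hN' : -pairQ (toQ v) g / pairQ (toQ u) g ≤ N := hN₀.trans (Nat.cast_le.2 hN)
      rw [div_le_iff₀ (hpos g hg hg0)] at hN'
      rw [toQ_add, toQ_nsmul, pairQ_add_left, pairQ_smul_left]
      linarith
  obtain ⟨N, hN⟩ := h.exists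
  exact ⟨⟨v + N • u, mem_dualCone_coneHull.2 hN⟩, ⟨N • u, nsmul_mem hu N⟩, by simp⟩

/-- A vector is determined by its pairings with a spanning set. -/
theorem eq_of_pairQ_eq_of_fullDim {G : Finset (Vec n)}
    (hfull : FullDim (coneHull (G : Set (Vec n)))) {a b : Vec n}
    (h : ∀ g ∈ G, pairQ a g = pairQ b g) : a = b := by
  have hall : ∀ p : Vec n, pairQ a p = pairQ b p := fun p => by
    have hp : p ∈ Submodule.span ℚ (coneHull (G : Set (Vec n))) := by
      rw [show Submodule.span ℚ (coneHull (G : Set (Vec n))) = ⊤ from hfull]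
      trivial
    induction hp using Submodule.span_induction with
    | mem x hx =>
      obtain ⟨H, c, hH, -, rfl⟩ := hx
      simp only [pairQ_sum_right, pairQ_smul_right]
      exact Finset.sum_congr rfl fun g hg => by rw [h g (hH hg)]
    | zero => simp [pairQ]
    | add x y _ _ hx hy => rw [pairQ_add_right, pairQ_add_right, hx, hy]
    | smul c x _ hx => rw [pairQ_smul_right, pairQ_smul_right, hx]
  exact dotProduct_eq a b hall

end Cones

/-- An additive map on a submonoid that generates the group extends to the group. -/
theorem AddSubmonoid.exists_extension {A H : Type*} [AddCommGroup A] [AddCommGroup H]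
    {S : AddSubmonoid A} (hS : ∀ v, ∃ a b : S, v = (a : A) - b) (f : S →+ H) :
    ∃ φ : A →+ H, ∀ s : S, φ s = f s := by
  choose a b hab using hS
  have key : ∀ (v : A) (x y : S), v = (x : A) - y → f (a v) - f (b v) = f x - f y :=
    fun v x y hv => by
      have : a v + y = x + b v := Subtype.ext (by
        have := (hab v).symm.trans hv
        simpa using sub_eq_sub_iff_add_eq_add.1 this)
      rw [sub_eq_sub_iff_add_eq_add, ← map_add, ← map_add, this]
  refine ⟨AddMonoidHom.mk' (fun v => f (a v) - f (b v)) fun v w => ?_, fun s => ?_⟩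
  · rw [key (v + w) (a v + a w) (b v + b w)]
    · simp only [map_add]
      abel
    · conv_lhs => rw [hab v, hab w]
      push_cast
      abel
  · simpa using key s s 0 (by simp)

section HomogeneousDerivation

open AddMonoidAlgebra

variable {K A : Type*} [Field K] [AddCommGroup A] {S : AddSubmonoid A}

theorem AddMonoidAlgebra.eq_of_single_eq_add {M : Type*} {a b d : M} {x y z : K}
    (h : (single a x : AddMonoidAlgebra K M) = single b y + single d z) :
    x = y + z ∧ (y ≠ 0 → z ≠ 0 → b = d) := by
  classical
  have h' : Finsupp.single a x = Finsupp.single b y + Finsupp.single d z := by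
    simpa using congrArg AddMonoidAlgebra.coeff h
  refine ⟨?_, fun hy hz => ?_⟩
  · have := congrArg (fun f : M →₀ K => f.sum fun _ r => r) h'
    simpa [Finsupp.sum_add_index'] using this
  · by_contra hbd
    have hb := DFunLike.congr_fun h' b
    have hd := DFunLike.congr_fun h' d
    simp only [Finsupp.add_apply, Finsupp.single_apply, Ne.symm hbd, hbd, if_true, if_false,
      add_zero, zero_add] at hb hd
    split_ifs at hb hd with h₁ h₂
    · exact hbd (h₁.symm.trans h₂)
    · exact hz hd.symm
    · exact hy hb.symm
    · exact hy hb.symm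

/-- A homogeneous derivation multiplies each character `χ^m` by a scalar `c m`, additive in `m`,
and shifts its degree by a fixed `e`. -/
theorem Derivation.exists_degree
    {D : Derivation K (AddMonoidAlgebra K S) (AddMonoidAlgebra K S)}
    (hhom : ∀ m : S, ∃ (m' : S) (c : K), D (single m (1 : K)) = single m' c) :
    ∃ (e : A) (c : S →+ K), ∀ m : S, ∃ m' : S,
      D (single m (1 : K)) = single m' (c m) ∧ (c m ≠ 0 → (m' : A) = m + e) := by
  choose t c hD using hhom
  have hadd : ∀ m l : S, (single (t (m + l)) (c (m + l)) : AddMonoidAlgebra K S) =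
      single (m + t l) (c l) + single (l + t m) (c m) := fun m l => by
    have h := D.leibniz (single m (1 : K)) (single l (1 : K))
    rw [single_mul_single, one_mul, hD, hD, hD, smul_eq_mul, smul_eq_mul, single_mul_single,
      single_mul_single, one_mul, one_mul] at h
    exact h
  let c' : S →+ K := AddMonoidHom.mk' c fun m l => by
    rw [(eq_of_single_eq_add (hadd m l)).1, add_comm]
  by_cases h0 : ∃ m, c m ≠ 0
  · obtain ⟨m₀, hm₀⟩ := h0
    refine ⟨(t m₀ : A) - m₀, c', fun m => ⟨t m, hD m, fun hm => ?_⟩⟩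
    have h := congrArg (Subtype.val) ((eq_of_single_eq_add (hadd m₀ m)).2 hm hm₀)
    push_cast at h
    rw [← add_sub_assoc, ← h, add_sub_cancel_left]
  · push Not at h0
    exact ⟨0, c', fun m => ⟨t m, hD m, fun hm => absurd (h0 m) hm⟩⟩

variable {D : Derivation K (AddMonoidAlgebra K S) (AddMonoidAlgebra K S)} {e : A} {c : S →+ K}

theorem Derivation.apply_eq_zero_iff_mem_span
    (hD : ∀ m : S, ∃ m' : S,
      D (single m (1 : K)) = single m' (c m) ∧ (c m ≠ 0 → (m' : A) = m + e))
    (x : AddMonoidAlgebra K S) :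
    D x = 0 ↔ x ∈ Submodule.span K
      {y : AddMonoidAlgebra K S | ∃ m : S, c m = 0 ∧ y = single m (1 : K)} := by
  classical
  choose t ht hte using hD
  have hsingle : ∀ (l : S) (r : K), D (single l r) = single (t l) (r * c l) := fun l r => by
    rw [show (single l r : AddMonoidAlgebra K S) = r • single l (1 : K) by simp, D.map_smul, ht]
    simp
  have hcoeff : ∀ m : S, c m ≠ 0 → ∀ x : AddMonoidAlgebra K S,
      (D x).coeff (t m) = x.coeff m * c m := by
    intro m hm x
    induction x using AddMonoidAlgebra.induction_linear with
    | zero => simp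
    | add x y hx hy => simp [hx, hy, add_mul]
    | single l r =>
      rw [hsingle, coeff_single, coeff_single, Finsupp.single_apply, Finsupp.single_apply]
      rcases eq_or_ne l m with rfl | hlm
      · simp
      · rcases eq_or_ne (c l) 0 with hl | hl
        · simp [hl, hlm]
        · have : t l ≠ t m := fun h => hlm <| Subtype.ext <| by
            have := congrArg Subtype.val h
            rw [hte l hl, hte m hm] at this
            exact add_right_cancel this
          simp [this, hlm]
  constructor
  · intro hx
    rw [← sum_coeff_single x]
    refine Submodule.sum_mem _ fun m hm => ?_
    have hcm : c m = 0 := by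
      by_contra hcm
      have := hcoeff m hcm x
      rw [hx] at this
      simp only [coeff_zero, Finsupp.coe_zero, Pi.zero_apply] at this
      exact (mul_ne_zero (Finsupp.mem_support_iff.1 hm) hcm) this.symm
    rw [show (single m (x.coeff m) : AddMonoidAlgebra K S) = x.coeff m • single m (1 : K) by simp]
    exact Submodule.smul_mem _ _ (Submodule.subset_span ⟨m, hcm, rfl⟩)
  · intro hx
    induction hx using Submodule.span_induction with
    | mem y hy =>
      obtain ⟨m, hm, rfl⟩ := hy
      rw [ht, hm, single_zero]
    | zero => exact map_zero D
    | add y z _ _ hy hz => rw [map_add, hy, hz, add_zero]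
    | smul r y _ hy => rw [D.map_smul, hy, smul_zero]

theorem Derivation.exists_add_nsmul_eq_zero (hlnd : IsLND D)
    (hD : ∀ m : S, ∃ m' : S,
      D (single m (1 : K)) = single m' (c m) ∧ (c m ≠ 0 → (m' : A) = m + e))
    {φ : A →+ K} (hφ : ∀ s : S, φ s = c s) (m : S) : ∃ i : ℕ, c m + i • φ e = 0 := by
  by_contra! hm
  obtain ⟨k, hk⟩ := hlnd (single m 1)
  induction k generalizing m with
  | zero => simp at hk
  | succ k ih =>
    obtain ⟨m', hDm, hm'⟩ := hD m
    have hcm : c m ≠ 0 := by simpa using hm 0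
    refine ih m' (fun i => ?_) ?_
    · rw [← hφ, hm' hcm, map_add, hφ, add_assoc, ← succ_nsmul']
      exact hm (i + 1)
    · rw [Function.iterate_succ_apply, hDm,
        show (single m' (c m) : AddMonoidAlgebra K S) = c m • single m' (1 : K) by simp] at hk
      have hsmul : (⇑D)^[k] (c m • single m' (1 : K)) = c m • (⇑D)^[k] (single m' 1) :=
        Function.Commute.iterate_left (f := D) (g := (c m • ·)) (D.map_smul (c m)) k _
      rw [hsmul] at hk
      exact (smul_eq_zero.1 hk).resolve_left hcm

/-- The functional attached to a locally nilpotent homogeneous derivation is, up to a scalar,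
integral, nonnegative on `S`, and takes the value `-1` on the degree of the derivation. -/
theorem Derivation.exists_integral_functional [CharZero K] (hlnd : IsLND D) (hDne : D ≠ 0)
    (hS : ∀ v, ∃ a b : S, v = (a : A) - b)
    (hD : ∀ m : S, ∃ m' : S,
      D (single m (1 : K)) = single m' (c m) ∧ (c m ≠ 0 → (m' : A) = m + e)) :
    ∃ ψ : A →+ ℤ, ψ e = -1 ∧ (∀ s : S, 0 ≤ ψ s) ∧ ∀ s : S, c s = 0 ↔ ψ s = 0 := by
  obtain ⟨φ, hφ⟩ := AddSubmonoid.exists_extension hS c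
  have hnil := Derivation.exists_add_nsmul_eq_zero hlnd hD hφ
  have he : φ e ≠ 0 := fun he => by
    refine hDne (Derivation.ext fun x => ?_)
    refine (Derivation.apply_eq_zero_iff_mem_span hD x).2 ?_
    rw [← sum_coeff_single x]
    refine Submodule.sum_mem _ fun m _ => ?_
    obtain ⟨i, hi⟩ := hnil m
    rw [show (single m (x.coeff m) : AddMonoidAlgebra K S) = x.coeff m • single m (1 : K) by simp]
    exact Submodule.smul_mem _ _ (Submodule.subset_span ⟨m, by simpa [he] using hi, rfl⟩)
  have hint : ∀ v, ∃ z : ℤ, φ v = -(z * φ e) := fun v => by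
    obtain ⟨a, b, rfl⟩ := hS v
    obtain ⟨i, hi⟩ := hnil a
    obtain ⟨j, hj⟩ := hnil b
    refine ⟨i - j, ?_⟩
    rw [nsmul_eq_mul] at hi hj
    rw [map_sub, hφ, hφ]
    push_cast
    linear_combination hi - hj
  choose z hz using hint
  have huniq : ∀ {v : A} {k : ℤ}, φ v = -(k * φ e) → z v = k := fun {v k} hk => by
    have := neg_injective ((hz v).symm.trans hk)
    exact_mod_cast mul_right_cancel₀ he this
  refine ⟨AddMonoidHom.mk' z fun v w => huniq ?_, huniq (by simp), fun s => ?_, fun s => ?_⟩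
  · rw [map_add, hz v, hz w]
    push_cast
    ring
  · obtain ⟨i, hi⟩ := hnil s
    rw [nsmul_eq_mul] at hi
    have : z s = i := huniq (by rw [hφ]; push_cast; linear_combination hi)
    simp [this]
  · rw [← hφ, hz]
    simp [he]

/-- The kernel of a derivation spanned by the characters of a finitely generated submonoid is
finitely generated. -/
theorem AddMonoidAlgebra.exists_adjoin_eq {M : Type*} [AddCommMonoid M] {T : AddSubmonoid M}
    (hT : T.FG) (D : Derivation K (AddMonoidAlgebra K M) (AddMonoidAlgebra K M))
    (hker : ∀ x, D x = 0 ↔ x ∈ Submodule.span K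
      {y : AddMonoidAlgebra K M | ∃ m : M, m ∈ T ∧ y = single m (1 : K)}) :
    ∃ s : Finset (AddMonoidAlgebra K M),
      (Algebra.adjoin K (↑s : Set (AddMonoidAlgebra K M)) : Set _) = {x | D x = 0} := by
  classical
  obtain ⟨X, rfl⟩ := hT
  refine ⟨X.image fun m => single m 1, Set.Subset.antisymm (fun x hx => ?_) fun x hx => ?_⟩
  · induction hx using Algebra.adjoin_induction with
    | mem y hy =>
      obtain ⟨m, hm, rfl⟩ := Finset.mem_image.1 hy
      exact (hker _).2 (Submodule.subset_span ⟨m, AddSubmonoid.subset_closure hm, rfl⟩)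
    | algebraMap r => exact D.map_algebraMap r
    | add y z _ _ hy hz =>
      change D (y + z) = 0
      rw [map_add, show D y = 0 from hy, show D z = 0 from hz, add_zero]
    | mul y z _ _ hy hz =>
      change D (y * z) = 0
      rw [D.leibniz, show D y = 0 from hy, show D z = 0 from hz, smul_zero, smul_zero, add_zero]
  · have hx' := (hker x).1 hx
    change x ∈ Subalgebra.toSubmodule (Algebra.adjoin K _)
    refine Submodule.span_le.2 ?_ hx'
    rintro _ ⟨m, hm, rfl⟩
    change single m (1 : K) ∈ Algebra.adjoin K _
    induction hm using AddSubmonoid.closure_induction with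
    | mem y hy => exact Algebra.subset_adjoin (Finset.mem_image_of_mem _ hy)
    | zero => exact one_mem _
    | add y z _ _ hy hz =>
      rw [show (single (y + z) (1 : K) : AddMonoidAlgebra K M) = single y 1 * single z 1 by
        simp [single_mul_single]]
      exact mul_mem hy hz

end HomogeneousDerivation

/-- **Gordan's lemma** for faces of the dual of a full-dimensional rational cone. -/
theorem fg_mker_latticeCone {n : ℕ} {G : Finset (Vec n)} (hG : ∀ g ∈ G, IsLatticeVec g)
    (hfull : FullDim (coneHull (G : Set (Vec n)))) (ψ : (Fin n → ℤ) →+ ℤ) :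
    (AddMonoidHom.mker (ψ.comp (latticeCone (coneHull (G : Set (Vec n)))).subtype)).FG := by
  set S := latticeCone (coneHull (G : Set (Vec n)))
  have hval : ∀ (m : S) (g : G), ∃ k : ℕ, (k : ℚ) = pairQ (toQ m) (g : Vec n) := fun m g => by
    choose z hz using hG g g.2
    have hz' : pairQ (toQ m) (g : Vec n) = ((∑ i, (m : Fin n → ℤ) i * z i : ℤ) : ℚ) := by
      simp [pairQ, toQ, hz]
    have hnn : 0 ≤ pairQ (toQ m) (g : Vec n) := mem_dualCone_coneHull.1 m.2 g g.2
    rw [hz'] at hnn ⊢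
    obtain ⟨k, hk⟩ := Int.eq_ofNat_of_zero_le (Int.cast_nonneg_iff.1 hnn)
    exact ⟨k, by rw [hk]; simp⟩
  choose k hk using hval
  let f : S →+ (G → ℕ) :=
    { toFun := k
      map_zero' := funext fun g => by
        have : (k 0 g : ℚ) = 0 := by rw [hk]; simp [pairQ, toQ]
        exact_mod_cast this
      map_add' := fun a b => funext fun g => by
        have : (k (a + b) g : ℚ) = k a g + k b g := by
          rw [hk, hk, hk, AddSubmonoid.coe_add, toQ_add, pairQ_add_left]
        exact_mod_cast this }
  have hf : ∀ m g, (f m g : ℚ) = pairQ (toQ m) (g : Vec n) := hk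
  have hinj : Function.Injective f := fun a b hab => by
    have h := eq_of_pairQ_eq_of_fullDim hfull (a := toQ a) (b := toQ b) fun g hg => by
      rw [← hf a ⟨g, hg⟩, ← hf b ⟨g, hg⟩, hab]
    refine Subtype.ext (funext fun i => ?_)
    exact Int.cast_injective (congrFun h i)
  refine AddSubmonoid.FG.map_injective f hinj (AddSubmonoid.fg_of_subtractive ?_)
  rintro _ ⟨a, ha, rfl⟩ y ⟨b, hb, hby⟩
  have hy : ∀ g : G, pairQ (toQ ((b : Fin n → ℤ) - (a : Fin n → ℤ))) (g : Vec n) = y g :=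
      fun g => by
    have h₁ : (f b g : ℚ) = f a g + y g := by exact_mod_cast congrFun hby g
    have h₂ : pairQ (toQ b) (g : Vec n) =
        pairQ (toQ ((b : Fin n → ℤ) - (a : Fin n → ℤ))) (g : Vec n) +
        pairQ (toQ a) (g : Vec n) := by
      rw [← pairQ_add_left, ← toQ_add, sub_add_cancel]
    rw [hf, hf] at h₁
    linarith
  refine ⟨⟨(b : Fin n → ℤ) - (a : Fin n → ℤ), mem_dualCone_coneHull.2 fun g hg => ?_⟩, ?_, ?_⟩
  · rw [hy ⟨g, hg⟩]
    exact Nat.cast_nonneg _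
  · have ha' : ψ a = 0 := ha
    have hb' : ψ b = 0 := hb
    change ψ ((b : Fin n → ℤ) - (a : Fin n → ℤ)) = 0
    rw [map_sub, ha', hb', sub_zero]
  · ext g
    have := hf ⟨(b : Fin n → ℤ) - (a : Fin n → ℤ), mem_dualCone_coneHull.2 fun g hg => by
      rw [hy ⟨g, hg⟩]; exact Nat.cast_nonneg _⟩ g
    rw [hy] at this
    exact_mod_cast this

/-- An integral vector `p` of a cone is a primitive generator of an extremal ray, provided
some lattice vector `e` pairs with `p` to `-1` and can be added to each lattice point of the dual
cone that is positive on `p`. -/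
theorem isExtremalRay_of_root {n : ℕ} {σ : Set (Vec n)}
    (hS : ∀ v, ∃ a b : latticeCone σ, v = (a : Fin n → ℤ) - b) {p : Vec n} (hp : IsLatticeVec p)
    (hpσ : ∀ c : ℚ, 0 ≤ c → c • p ∈ σ) {e : Fin n → ℤ} (he : pairQ (toQ e) p = -1)
    (hshift : ∀ m ∈ latticeCone σ, pairQ (toQ m) p ≠ 0 → m + e ∈ latticeCone σ) :
    IsExtremalRay σ {x | ∃ c : ℚ, 0 ≤ c ∧ x = c • p} p := by
  have hp0 : p ≠ 0 := by
    rintro rfl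
    simp [pairQ] at he
  have hint : ∀ (q : Vec n), IsLatticeVec q → ∀ m : Fin n → ℤ, ∃ z : ℤ, pairQ (toQ m) q = z :=
    fun q hq m => by
      choose z hz using hq
      exact ⟨∑ i, m i * z i, by simp [pairQ, toQ, hz]⟩
  refine ⟨hp, hp0, fun c hc hcp => ?_, rfl, ?_, ?_⟩
  · obtain ⟨z, hz⟩ := hint _ hcp e
    rw [pairQ_smul_right, he] at hz
    have hzc : c = ((-z : ℤ) : ℚ) := by push_cast; linarith
    rw [hzc] at hc ⊢
    exact_mod_cast (Int.cast_pos.1 hc : 0 < -z)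
  · rintro _ ⟨c, hc, rfl⟩
    exact hpσ c hc
  · rintro x hx y hy ⟨t, ht, hxy⟩
    have hface : ∀ m ∈ latticeCone σ, pairQ (toQ m) p = 0 → pairQ (toQ m) x = 0 :=
      fun m hm hmp => by
        have h : pairQ (toQ m) (x + y) = 0 := by rw [hxy, pairQ_smul_right, hmp, mul_zero]
        rw [pairQ_add_right] at h
        have h₁ := hm x hx
        have h₂ := hm y hy
        linarith
    have hprop : ∀ (k : ℕ), ∀ m ∈ latticeCone σ, pairQ (toQ m) p = k →
        pairQ (toQ m) x = -pairQ (toQ e) x * pairQ (toQ m) p := fun k => by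
      induction k with
      | zero =>
        intro m hm hk
        have hk' : pairQ (toQ m) p = 0 := by simpa using hk
        rw [hface m hm hk', hk', mul_zero]
      | succ k ih =>
        intro m hm hk
        have hm' := hshift m hm (by rw [hk]; positivity)
        have h := ih (m + e) hm' (by
          rw [toQ_add, pairQ_add_left, hk, he]; push_cast; ring)
        rw [toQ_add, pairQ_add_left, pairQ_add_left, he] at h
        linarith
    have hp1 : p ∈ σ := by simpa using hpσ 1 zero_le_one
    have hpropS : ∀ m ∈ latticeCone σ,
        pairQ (toQ m) x = -pairQ (toQ e) x * pairQ (toQ m) p := fun m hm => by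
      obtain ⟨z, hz⟩ := hint p hp m
      have hnn := hm p hp1
      rw [hz] at hnn
      obtain ⟨k, rfl⟩ := Int.eq_ofNat_of_zero_le (Int.cast_nonneg_iff.1 hnn)
      exact hprop k m hm (by simpa using hz)
    obtain ⟨a, b, hab⟩ := hS e
    refine ⟨-pairQ (toQ e) x, ?_, ?_⟩
    · have hb : 0 < pairQ (toQ b) p := by
        have h₁ := a.2 p hp1
        have h₂ : pairQ (toQ a) p = pairQ (toQ e) p + pairQ (toQ b) p := by
          rw [← pairQ_add_left, ← toQ_add, hab, sub_add_cancel]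
        rw [he] at h₂
        linarith
      have hbx := b.2 x hx
      rw [hpropS b b.2] at hbx
      exact nonneg_of_mul_nonneg_left hbx hb
    · ext i
      obtain ⟨a, b, hab⟩ := hS (Pi.single i 1)
      have hi : (Pi.single i 1 : Vec n) + toQ b = toQ a := by
        have : toQ (Pi.single i 1 : Fin n → ℤ) = (Pi.single i 1 : Vec n) := by
          ext j
          rcases eq_or_ne j i with rfl | hj <;> simp [toQ, *]
        rw [← this, ← toQ_add, hab, sub_add_cancel]
      have h : ∀ q : Vec n, q i = pairQ (toQ a) q - pairQ (toQ b) q := fun q => by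
        rw [← hi, pairQ_add_left, pairQ_single_left, add_sub_cancel_right]
      rw [Pi.smul_apply, smul_eq_mul, h x, h p, hpropS a a.2, hpropS b b.2]
      ring



open AddMonoidAlgebra in
/-- The kernel of a nonzero homogeneous locally nilpotent derivation on the affine
semigroup algebra `A = K[σ^∨ ∩ M]` is `K[τ ∩ M]` for some facet `τ = σ^∨ ∩ ρ^⊥` of
`σ^∨` (dual to an extremal ray `ρ` of `σ`); in particular the kernel is a finitely
generated `K`-algebra. -/
theorem stmt12 {n : ℕ} (K : Type*) [Field K] [CharZero K]
    (σ : Set (Vec n))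
    (hσ : IsRatPolyCone σ) (hpt : PointedCone' σ) (hfull : FullDim σ)
    (D : Derivation K (AddMonoidAlgebra K ↥(latticeCone σ))
        (AddMonoidAlgebra K ↥(latticeCone σ)))
    (hDne : D ≠ 0) (hlnd : IsLND D)
    (hhom : ∀ m : latticeCone σ, ∃ (m' : latticeCone σ) (c : K),
      D (single m (1 : K)) = single m' c) :
    (∃ (ρ : Set (Vec n)) (ν : Vec n), IsExtremalRay σ ρ ν ∧
      ∀ x, D x = 0 ↔ x ∈ Submodule.span K
        {y : AddMonoidAlgebra K ↥(latticeCone σ) |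
          ∃ m : latticeCone σ, pairQ (toQ m) ν = 0 ∧ y = single m (1 : K)}) ∧
    ∃ s : Finset (AddMonoidAlgebra K ↥(latticeCone σ)),
      (Algebra.adjoin K (↑s : Set (AddMonoidAlgebra K ↥(latticeCone σ))) : Set _) =
        {x | D x = 0} := by
  obtain ⟨G, hG, rfl⟩ := hσ
  have hS := exists_eq_sub_latticeCone hpt
  obtain ⟨e, c, hD⟩ := Derivation.exists_degree hhom
  obtain ⟨ψ, hψe, hψnn, hψc⟩ := Derivation.exists_integral_functional hlnd hDne hS hD
  let p : Vec n := fun i => (ψ (Pi.single i 1) : ℚ)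
  have hp : ∀ m : Fin n → ℤ, pairQ (toQ m) p = ψ m := fun m => by
    have hm : m = ∑ i, m i • (Pi.single i 1 : Fin n → ℤ) := by
      ext j
      simp [Finset.sum_apply, Pi.single_apply]
    conv_rhs => rw [hm, map_sum]
    simp only [map_zsmul, pairQ, toQ, p, smul_eq_mul, Int.cast_sum, Int.cast_mul]
  have hray := isExtremalRay_of_root hS (p := p) (e := e) (fun i => ⟨_, rfl⟩)
    (fun c hc => mem_coneHull_of_forall_latticeCone fun m hm => by
      rw [pairQ_smul_right, hp]
      exact mul_nonneg hc (Int.cast_nonneg (hψnn ⟨m, hm⟩)))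
    (by rw [hp, hψe]; simp)
    (fun m hm hmp => by
      obtain ⟨m', -, hm'⟩ := hD ⟨m, hm⟩
      rw [hp] at hmp
      rw [← hm' fun h => hmp (by rw [(hψc ⟨m, hm⟩).1 h, Int.cast_zero])]
      exact m'.2)
  have hker := Derivation.apply_eq_zero_iff_mem_span hD
  refine ⟨⟨_, p, hray, fun x => ?_⟩,
    AddMonoidAlgebra.exists_adjoin_eq (fg_mker_latticeCone hG hfull ψ) D fun x => ?_⟩
  · simpa only [hp, Int.cast_eq_zero, ← hψc] using hker x
  · simpa only [hψc, AddMonoidHom.mem_mker, AddMonoidHom.comp_apply,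
      AddSubmonoid.coe_subtype] using hker x
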